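/- arXiv:1702.02767 — 3 statements merged into one kernel-verified Lean document; each statement's English description precedes it below -/
import Mathlib

section
/- There exist a constant c > 0 and a natural number N such that for every n ≥ N and every θ ∈ [0, π], one has (1 − P_n(cos θ))² ≥ c · (2 − 2 P_n(cos θ) − (P_n'(cos θ) · sin θ)² / P_n'(1)). (This is the analytic form of the uniform lower bound on the critical radius of the level-n spherical-harmonic immersion of S², valid for both even and odd n.) -/
open Real

/-- The degree-`n` Legendre polynomial, via the Rodrigues formula
`P_n(x) = (1/(2^n n!)) (d/dx)^n (x² − 1)^n`. -/
noncomputable def legendre (n : ℕ) (x : ℝ) : ℝ :=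
  (1 / (2 ^ n * (n.factorial : ℝ))) * iteratedDeriv n (fun t : ℝ => (t ^ 2 - 1) ^ n) x

open Polynomial in
/-- Differentiating `(X² - 1) q' = 2 n X q` repeatedly, where `q = (X² - 1) ^ n`. -/
lemma iterate_derivative_sq_sub_one_pow (n k : ℕ) :
    (X ^ 2 - 1) * derivative^[k + 2] ((X ^ 2 - 1 : ℝ[X]) ^ n)
      + (2 * ((k : ℝ[X]) + 1) - 2 * (n : ℝ[X])) * X * derivative^[k + 1] ((X ^ 2 - 1 : ℝ[X]) ^ n)
      + (((k : ℝ[X]) + 1) * (k : ℝ[X]) - 2 * (n : ℝ[X]) * ((k : ℝ[X]) + 1)) *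
        derivative^[k] ((X ^ 2 - 1 : ℝ[X]) ^ n) = 0 := by
  induction k with
  | zero =>
    have h : (X ^ 2 - 1) * derivative ((X ^ 2 - 1 : ℝ[X]) ^ n)
        = 2 * (n : ℝ[X]) * X * (X ^ 2 - 1 : ℝ[X]) ^ n := by
      cases n with
      | zero => simp
      | succ m =>
        simp only [derivative_pow, derivative_sub, derivative_X, derivative_one, map_natCast,
          Nat.add_sub_cancel]
        push_cast
        ring
    have hder := congrArg derivative h
    simp only [derivative_mul, derivative_sub, derivative_pow, derivative_X, derivative_one,
      derivative_natCast, derivative_ofNat, map_natCast] at hder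
    simp only [Function.iterate_succ_apply', Function.iterate_zero_apply, derivative_pow,
      derivative_sub, derivative_X, derivative_one, map_natCast, derivative_mul,
      derivative_natCast] at hder ⊢
    push_cast at hder ⊢
    linear_combination hder
  | succ k ih =>
    have hder := congrArg derivative ih
    simp only [derivative_mul, derivative_add, derivative_sub, derivative_X_pow, derivative_X,
      derivative_one, derivative_natCast, derivative_ofNat, derivative_zero, map_natCast,
      ← Function.iterate_succ_apply' (f := derivative)] at hder
    push_cast at hder ⊢
    linear_combination hder

/-- The Legendre polynomial as an element of `ℝ[X]`. -/
noncomputable def legendrePoly (n : ℕ) : Polynomial ℝ :=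
  Polynomial.C (1 / (2 ^ n * (n.factorial : ℝ))) *
    Polynomial.derivative^[n] ((Polynomial.X ^ 2 - 1) ^ n)

lemma iteratedDeriv_polynomial_eval (q : Polynomial ℝ) (k : ℕ) :
    iteratedDeriv k (fun t => q.eval t) = fun t => (Polynomial.derivative^[k] q).eval t := by
  induction k with
  | zero => simp
  | succ k ih =>
    rw [iteratedDeriv_succ, ih, Function.iterate_succ_apply']
    funext t
    exact Polynomial.deriv _

lemma legendre_eq_eval (n : ℕ) : legendre n = fun x => (legendrePoly n).eval x := by
  funext x
  have h : (fun t : ℝ => (t ^ 2 - 1) ^ n)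
      = fun t => ((Polynomial.X ^ 2 - 1 : Polynomial ℝ) ^ n).eval t := by
    funext t; simp
  rw [legendre, legendrePoly, h, iteratedDeriv_polynomial_eval, Polynomial.eval_mul,
    Polynomial.eval_C]

open Polynomial in
lemma eval_one_legendrePoly (n : ℕ) : (legendrePoly n).eval 1 = 1 := by
  have h : ((X ^ 2 - 1 : ℝ[X]) ^ n) = (X - C 1) ^ n * (X + 1) ^ n := by
    rw [← mul_pow]; congr 1; simp; ring
  have h2 := aeval_iterate_derivative_self (A := ℝ) ((X ^ 2 - 1 : ℝ[X]) ^ n) n (r := 1)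
    (p' := (X + 1) ^ n) (by simpa using h)
  rw [legendrePoly, eval_mul, eval_C]
  simp only [coe_aeval_eq_eval] at h2
  rw [h2]
  have := n.factorial_ne_zero
  simp
  norm_num
  field_simp

open Polynomial in
/-- Legendre's differential equation. -/
lemma legendrePoly_ode (n : ℕ) (x : ℝ) :
    (1 - x ^ 2) * (derivative (derivative (legendrePoly n))).eval x
      = 2 * x * (derivative (legendrePoly n)).eval x
        - n * (n + 1) * (legendrePoly n).eval x := by
  have h := congrArg (eval x) (iterate_derivative_sq_sub_one_pow n n)
  simp only [Function.iterate_succ_apply', eval_add, eval_mul, eval_sub, eval_pow, eval_X,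
    eval_one, eval_natCast, eval_ofNat, eval_zero] at h
  simp only [legendrePoly, derivative_C_mul, eval_mul, eval_C]
  linear_combination (-(1 / (2 ^ n * (n.factorial : ℝ)))) * h

lemma legendre_neg (n : ℕ) (x : ℝ) : legendre n (-x) = (-1) ^ n * legendre n x := by
  have h := iteratedDeriv_comp_neg n (fun t : ℝ => (t ^ 2 - 1) ^ n) x
  simp only [neg_sq, smul_eq_mul] at h
  simp only [legendre, h]
  have : ((-1 : ℝ) ^ n) * (-1) ^ n = 1 := by rw [← mul_pow]; simp
  linear_combination (-(1 / (2 ^ n * (n.factorial : ℝ))) *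
    iteratedDeriv n (fun t : ℝ => (t ^ 2 - 1) ^ n) (-x)) * this

lemma le_of_hasDerivAt_nonneg {F dF : ℝ → ℝ} {a b : ℝ} (hab : a ≤ b)
    (hF : ∀ x, HasDerivAt F (dF x) x) (h0 : ∀ x, a ≤ x → x < b → 0 ≤ dF x) : F a ≤ F b := by
  refine monotoneOn_of_deriv_nonneg (convex_Icc a b)
    (fun x _ => (hF x).continuousAt.continuousWithinAt)
    (fun x _ => (hF x).differentiableAt.differentiableWithinAt) (fun x hx => ?_)
    (Set.left_mem_Icc.2 hab) (Set.right_mem_Icc.2 hab) hab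
  rw [interior_Icc] at hx
  rw [(hF x).deriv]
  exact h0 x hx.1.le hx.2

section LegendreEquation

variable {f g h : ℝ → ℝ} {l : ℝ}

lemma hasDerivAt_energy (hl : 2 ≤ l) (hf : ∀ x, HasDerivAt f (g x) x)
    (hg : ∀ x, HasDerivAt g (h x) x)
    (ode : ∀ x, (1 - x ^ 2) * h x = 2 * x * g x - l * f x) (x : ℝ) :
    HasDerivAt (fun x => f x ^ 2 + (1 - x ^ 2) * g x ^ 2 / l) (2 * x * g x ^ 2 / l) x := by
  have h1 := ((hf x).pow 2).add
    (((((hasDerivAt_id x).pow 2).const_sub 1).mul ((hg x).pow 2)).div_const l)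
  refine h1.congr_deriv ?_
  have : l ≠ 0 := by linarith
  simp only [id, Pi.pow_apply]
  field_simp
  push_cast
  linear_combination (2 * g x) * ode x

lemma energy_mono (hl : 2 ≤ l) (hf : ∀ x, HasDerivAt f (g x) x)
    (hg : ∀ x, HasDerivAt g (h x) x)
    (ode : ∀ x, (1 - x ^ 2) * h x = 2 * x * g x - l * f x) {x y : ℝ} (hx : 0 ≤ x)
    (hxy : x ≤ y) :
    f x ^ 2 + (1 - x ^ 2) * g x ^ 2 / l ≤ f y ^ 2 + (1 - y ^ 2) * g y ^ 2 / l :=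
  le_of_hasDerivAt_nonneg hxy (hasDerivAt_energy hl hf hg ode) fun t ht _ => by
    have : 0 ≤ t := hx.trans ht
    positivity

lemma sq_le_energy (hl : 2 ≤ l) {x : ℝ} (hx : 0 ≤ x) (hx1 : x ≤ 1) :
    f x ^ 2 ≤ f x ^ 2 + (1 - x ^ 2) * g x ^ 2 / l := by
  have : 0 ≤ 1 - x ^ 2 := by nlinarith
  have : 0 ≤ (1 - x ^ 2) * g x ^ 2 / l := by positivity
  linarith

lemma sq_le_one_of_legendre_ode (hl : 2 ≤ l) (hf : ∀ x, HasDerivAt f (g x) x)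
    (hg : ∀ x, HasDerivAt g (h x) x)
    (ode : ∀ x, (1 - x ^ 2) * h x = 2 * x * g x - l * f x) (f1 : f 1 = 1)
    {x : ℝ} (hx : 0 ≤ x) (hx1 : x ≤ 1) : f x ^ 2 ≤ 1 := by
  have h1 := energy_mono hl hf hg ode hx hx1
  have h2 := sq_le_energy (f := f) (g := g) hl hx hx1
  simp only [f1] at h1
  norm_num at h1
  linarith

lemma hasDerivAt_flux (hg : ∀ x, HasDerivAt g (h x) x)
    (ode : ∀ x, (1 - x ^ 2) * h x = 2 * x * g x - l * f x) (x : ℝ) :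
    HasDerivAt (fun x => (1 - x ^ 2) * g x) (-l * f x) x := by
  have h1 := (((hasDerivAt_id x).pow 2).const_sub 1).mul (hg x)
  refine h1.congr_deriv ?_
  simp only [id, Pi.pow_apply]
  push_cast
  linear_combination ode x

lemma one_add_mul_deriv_le (hl : 2 ≤ l) (hf : ∀ x, HasDerivAt f (g x) x)
    (hg : ∀ x, HasDerivAt g (h x) x)
    (ode : ∀ x, (1 - x ^ 2) * h x = 2 * x * g x - l * f x) (f1 : f 1 = 1)
    {x : ℝ} (hx : 0 ≤ x) (hx1 : x < 1) : (1 + x) * g x ≤ l := by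
  have h1 := le_of_hasDerivAt_nonneg hx1.le
    (fun t => (hasDerivAt_flux hg ode t).add ((hasDerivAt_id t).const_mul l))
    (fun t ht ht1 => by
      have := sq_le_one_of_legendre_ode hl hf hg ode f1 (hx.trans ht) ht1.le
      have : f t ≤ 1 := by nlinarith
      nlinarith)
  simp only [Pi.add_apply, id] at h1
  have h2 : 0 < 1 - x := by linarith
  refine le_of_mul_le_mul_left ?_ h2
  nlinarith

lemma one_add_mul_one_sub_le (hl : 2 ≤ l) (hf : ∀ x, HasDerivAt f (g x) x)
    (hg : ∀ x, HasDerivAt g (h x) x)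
    (ode : ∀ x, (1 - x ^ 2) * h x = 2 * x * g x - l * f x) (f1 : f 1 = 1)
    {x : ℝ} (hx : 0 ≤ x) (hx1 : x ≤ 1) : (1 + x) * (1 - f x) ≤ l * (1 - x) := by
  have h1 := le_of_hasDerivAt_nonneg hx1
    (fun t => ((hasDerivAt_id t).const_mul l).sub ((hf t).const_mul (1 + x)))
    (fun t ht ht1 => by
      have := one_add_mul_deriv_le hl hf hg ode f1 (hx.trans ht) ht1
      rcases le_or_gt (g t) 0 with h0 | h0 <;> nlinarith)
  simp only [Pi.sub_apply, id, f1] at h1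
  nlinarith

lemma flux_lower_bound (hl : 2 ≤ l) (hf : ∀ x, HasDerivAt f (g x) x)
    (hg : ∀ x, HasDerivAt g (h x) x)
    (ode : ∀ x, (1 - x ^ 2) * h x = 2 * x * g x - l * f x) (f1 : f 1 = 1)
    {x : ℝ} (hx : 0 ≤ x) (hx1 : x ≤ 1) :
    l * (1 - x) * (1 - l * (1 - x) / 2) ≤ (1 - x ^ 2) * g x := by
  have h1 := le_of_hasDerivAt_nonneg hx1
    (fun t => ((((hasDerivAt_id t).const_sub 1).const_mul l).sub
      ((((hasDerivAt_id t).const_sub 1).pow 2).const_mul (l ^ 2 / 2))).sub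
      (hasDerivAt_flux hg ode t))
    (fun t ht ht1 => by
      have h2 := one_add_mul_one_sub_le hl hf hg ode f1 (hx.trans ht) ht1.le
      have h3 := sq_le_one_of_legendre_ode hl hf hg ode f1 (hx.trans ht) ht1.le
      have h4 : f t ≤ 1 := by nlinarith
      have h5 : 1 - f t ≤ l * (1 - t) := by nlinarith
      simp only [id]
      push_cast
      nlinarith)
  simp only [Pi.sub_apply, Pi.pow_apply, id] at h1
  norm_num at h1
  nlinarith

lemma deriv_lower_bound (hl : 2 ≤ l) (hf : ∀ x, HasDerivAt f (g x) x)
    (hg : ∀ x, HasDerivAt g (h x) x)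
    (ode : ∀ x, (1 - x ^ 2) * h x = 2 * x * g x - l * f x) (f1 : f 1 = 1)
    {x : ℝ} (hx1 : x < 1) (hlx : l * (1 - x) ≤ 1) : l / 4 ≤ g x := by
  have hx : 0 ≤ x := by nlinarith
  have h1 := flux_lower_bound hl hf hg ode f1 hx hx1.le
  have h2 : 0 < 1 - x := by linarith
  have h3 : l * (1 - l * (1 - x) / 2) ≤ (1 + x) * g x := by
    refine le_of_mul_le_mul_left ?_ h2
    nlinarith
  have h4 : l / 2 ≤ (1 + x) * g x := by nlinarith
  by_contra! h5
  nlinarith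

lemma one_sub_lower_bound (hl : 2 ≤ l) (hf : ∀ x, HasDerivAt f (g x) x)
    (hg : ∀ x, HasDerivAt g (h x) x)
    (ode : ∀ x, (1 - x ^ 2) * h x = 2 * x * g x - l * f x) (f1 : f 1 = 1)
    {x : ℝ} (hx1 : x ≤ 1) (hlx : l * (1 - x) ≤ 1) : l * (1 - x) / 4 ≤ 1 - f x := by
  have h1 := le_of_hasDerivAt_nonneg hx1
    (fun t => (hf t).sub ((hasDerivAt_id t).const_mul (l / 4)))
    (fun t ht ht1 => by
      have := deriv_lower_bound hl hf hg ode f1 ht1 (by nlinarith)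
      linarith)
  simp only [Pi.sub_apply, id, f1] at h1
  linarith

lemma sq_le_of_one_le_mul (hl : 2 ≤ l) (hf : ∀ x, HasDerivAt f (g x) x)
    (hg : ∀ x, HasDerivAt g (h x) x)
    (ode : ∀ x, (1 - x ^ 2) * h x = 2 * x * g x - l * f x) (f1 : f 1 = 1)
    {x : ℝ} (hx : 0 ≤ x) (hlx : 1 ≤ l * (1 - x)) : f x ^ 2 ≤ 15 / 16 := by
  have hl0 : 0 < l := by linarith
  obtain ⟨a, ha⟩ : ∃ a, l * (1 - a) = 1 := ⟨1 - 1 / l, by field_simp; ring⟩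
  have hxa : x ≤ a := by nlinarith
  have ha1 : a ≤ 1 := by nlinarith
  have ha2 : 1 / 2 ≤ a := by nlinarith
  have h1 := le_of_hasDerivAt_nonneg ha1
    (fun t => (hasDerivAt_energy hl hf hg ode t).sub ((hasDerivAt_id t).const_mul (l / 16)))
    (fun t ht ht1 => by
      have h2 := deriv_lower_bound hl hf hg ode f1 ht1 (by nlinarith)
      have h3 : (l / 4) ^ 2 ≤ g t ^ 2 := by gcongr
      have h4 : l / 16 ≤ 2 * t * g t ^ 2 / l := by
        rw [le_div_iff₀ hl0]
        nlinarith
      linarith)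
  have h2 := energy_mono hl hf hg ode hx hxa
  have h3 := sq_le_energy (f := f) (g := g) hl hx (hxa.trans ha1)
  simp only [Pi.sub_apply, id, f1] at h1
  norm_num at h1
  linarith

lemma neg_le_of_legendre_ode (hl : 2 ≤ l) (hf : ∀ x, HasDerivAt f (g x) x)
    (hg : ∀ x, HasDerivAt g (h x) x)
    (ode : ∀ x, (1 - x ^ 2) * h x = 2 * x * g x - l * f x) (f1 : f 1 = 1)
    {x : ℝ} (hx : 0 ≤ x) (hx1 : x ≤ 1) : -(31 / 32) ≤ f x := by
  rcases le_total 1 (l * (1 - x)) with h1 | h1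
  · have := sq_le_of_one_le_mul hl hf hg ode f1 hx h1
    nlinarith
  · have := one_add_mul_one_sub_le hl hf hg ode f1 hx hx1
    nlinarith

lemma defect_le_of_one_sub_ge (hl : 2 ≤ l) {p q x : ℝ} (hx1 : x ^ 2 ≤ 1)
    (hp : 1 / 32 ≤ 1 - p) :
    2 - 2 * p - 2 * (1 - x ^ 2) * q ^ 2 / l ≤ 64 * (1 - p) ^ 2 := by
  have : 0 ≤ 1 - x ^ 2 := by linarith
  have : 0 ≤ 2 * (1 - x ^ 2) * q ^ 2 / l := by positivity
  nlinarith

lemma defect_le_of_legendre_ode (hl : 2 ≤ l) (hf : ∀ x, HasDerivAt f (g x) x)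
    (hg : ∀ x, HasDerivAt g (h x) x)
    (ode : ∀ x, (1 - x ^ 2) * h x = 2 * x * g x - l * f x) (f1 : f 1 = 1)
    {x : ℝ} (hx : 0 ≤ x) (hx1 : x ≤ 1) :
    2 - 2 * f x - 2 * (1 - x ^ 2) * g x ^ 2 / l ≤ 64 * (1 - f x) ^ 2 := by
  rcases le_total 1 (l * (1 - x)) with h1 | h1
  · have := sq_le_of_one_le_mul hl hf hg ode f1 hx h1
    exact defect_le_of_one_sub_ge hl (by nlinarith) (by nlinarith)
  rcases hx1.eq_or_lt with rfl | hxlt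
  · norm_num [f1]
  have hl0 : 0 < l := by linarith
  have h2 := one_sub_lower_bound hl hf hg ode f1 hx1 h1
  have h3 := one_add_mul_one_sub_le hl hf hg ode f1 hx hx1
  have h4 := flux_lower_bound hl hf hg ode f1 hx hx1
  obtain ⟨s, hs⟩ : ∃ s, l * (1 - x) = s := ⟨_, rfl⟩
  rw [hs] at h1 h2 h3 h4
  have hu : 0 < 1 - x := by linarith
  have hs0 : 0 < s := hs ▸ mul_pos hl0 hu
  have h5 : s ^ 2 * (1 - s) ≤ ((1 - x ^ 2) * g x) ^ 2 :=
    calc s ^ 2 * (1 - s) ≤ (s * (1 - s / 2)) ^ 2 := by nlinarith [sq_nonneg (s ^ 2)]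
      _ ≤ _ := by
        have : 0 ≤ 1 - s / 2 := by linarith
        gcongr
  have h6 : s * (1 - s) ≤ (1 + x) * ((1 - x ^ 2) * g x ^ 2 / l) := by
    refine le_of_mul_le_mul_left ?_ hs0
    have : s * ((1 + x) * ((1 - x ^ 2) * g x ^ 2 / l)) = ((1 - x ^ 2) * g x) ^ 2 := by
      rw [← hs]; field_simp; ring
    rw [this]
    linarith
  have h7 : (s / 4) ^ 2 ≤ (1 - f x) ^ 2 := by gcongr
  have h8 : (1 + x) * (1 - f x - (1 - x ^ 2) * g x ^ 2 / l) ≤ s ^ 2 := by nlinarith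
  have h9 : 1 - f x - (1 - x ^ 2) * g x ^ 2 / l ≤ s ^ 2 := by
    by_contra! h10
    nlinarith [sq_nonneg s]
  have h10 : 2 * (1 - x ^ 2) * g x ^ 2 / l = 2 * ((1 - x ^ 2) * g x ^ 2 / l) := by ring
  rw [h10]
  nlinarith

end LegendreEquation

lemma hasDerivAt_legendre (n : ℕ) (x : ℝ) :
    HasDerivAt (legendre n) ((legendrePoly n).derivative.eval x) x := by
  rw [legendre_eq_eval]
  exact (legendrePoly n).hasDerivAt x

lemma deriv_legendre_neg (n : ℕ) (x : ℝ) :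
    deriv (legendre n) (-x) ^ 2 = deriv (legendre n) x ^ 2 := by
  have h : (fun y => legendre n (-y)) = fun y => (-1) ^ n * legendre n y :=
    funext (legendre_neg n)
  have h1 := congrFun (congrArg deriv h) x
  rw [deriv_comp_neg, deriv_const_mul _ (hasDerivAt_legendre n x).differentiableAt] at h1
  calc deriv (legendre n) (-x) ^ 2 = (-deriv (legendre n) (-x)) ^ 2 := by ring
    _ = _ := by rw [h1, mul_pow, ← pow_mul, mul_comm n 2, pow_mul]; simp

lemma deriv_legendre_one (n : ℕ) : deriv (legendre n) 1 = n * (n + 1) / 2 := by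
  have h := legendrePoly_ode n 1
  rw [eval_one_legendrePoly] at h
  rw [(hasDerivAt_legendre n 1).deriv]
  linarith

lemma legendre_defect_le {n : ℕ} (hn : 1 ≤ n) {x : ℝ} (hx : -1 ≤ x) (hx1 : x ≤ 1) :
    2 - 2 * legendre n x - 2 * (1 - x ^ 2) * deriv (legendre n) x ^ 2 / (n * (n + 1))
      ≤ 64 * (1 - legendre n x) ^ 2 := by
  have hn1 : (1 : ℝ) ≤ n := by exact_mod_cast hn
  have hl : (2 : ℝ) ≤ n * (n + 1) := by nlinarith
  have hf : ∀ y, HasDerivAt (legendre n) (deriv (legendre n) y) y := fun y =>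
    (hasDerivAt_legendre n y).differentiableAt.hasDerivAt
  have hd : deriv (legendre n) = fun y => (legendrePoly n).derivative.eval y :=
    funext fun y => (hasDerivAt_legendre n y).deriv
  have hg : ∀ y, HasDerivAt (deriv (legendre n))
      ((legendrePoly n).derivative.derivative.eval y) y := fun y => by
    rw [hd]; exact (legendrePoly n).derivative.hasDerivAt y
  have ode : ∀ y : ℝ, (1 - y ^ 2) * (legendrePoly n).derivative.derivative.eval y
      = 2 * y * deriv (legendre n) y - n * (n + 1) * legendre n y := fun y => by
    rw [hd, legendre_eq_eval]; exact legendrePoly_ode n y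
  have f1 : legendre n 1 = 1 := by rw [legendre_eq_eval]; exact eval_one_legendrePoly n
  rcases le_total 0 x with h0 | h0
  · exact defect_le_of_legendre_ode hl hf hg ode f1 h0 hx1
  have hnx0 : 0 ≤ -x := by linarith
  have hnx1 : -x ≤ 1 := by linarith
  have hneg := legendre_neg n x
  rcases n.even_or_odd with he | ho
  · have h1 := defect_le_of_legendre_ode hl hf hg ode f1 hnx0 hnx1
    rwa [deriv_legendre_neg, hneg, he.neg_one_pow, one_mul, neg_sq] at h1
  · have h1 := neg_le_of_legendre_ode hl hf hg ode f1 hnx0 hnx1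
    rw [hneg, ho.neg_one_pow] at h1
    exact defect_le_of_one_sub_ge hl (by nlinarith) (by linarith)

/-- There are `c > 0` and `N` such that for all `n ≥ N` and `θ ∈ [0, π]`,
`(1 − P_n(cos θ))² ≥ c (2 − 2 P_n(cos θ) − (P_n'(cos θ) sin θ)²/P_n'(1))`. -/
theorem uniform_lower_bound_critical_radius_S2 :
    ∃ c : ℝ, 0 < c ∧ ∃ N : ℕ, ∀ n : ℕ, N ≤ n → ∀ θ ∈ Set.Icc (0 : ℝ) π,
      (1 - legendre n (cos θ)) ^ 2 ≥
        c * (2 - 2 * legendre n (cos θ) -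
          (deriv (legendre n) (cos θ) * sin θ) ^ 2 / deriv (legendre n) 1) := by
  refine ⟨1 / 64, by norm_num, 1, fun n hn θ _ => ?_⟩
  have h := legendre_defect_le hn (neg_one_le_cos θ) (cos_le_one θ)
  rw [← sin_sq] at h
  have h1 : (deriv (legendre n) (cos θ) * sin θ) ^ 2 / deriv (legendre n) 1
      = 2 * sin θ ^ 2 * deriv (legendre n) (cos θ) ^ 2 / (n * (n + 1)) := by
    have : (n : ℝ) ≠ 0 := by positivity
    rw [deriv_legendre_one]
    field_simp
  rw [h1]
  linarith
end

section
/- For every c > 0 there exists a constant C such that for all n ≥ 1, sup_{y ∈ [0, c]} |P_n(cos(y/n)) − J₀(y)| ≤ C/n. -/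
open Real

/-- The Bessel function of the first kind of order `0`. -/
noncomputable def besselJ0 (y : ℝ) : ℝ :=
  ∑' j : ℕ, (-1) ^ j / ((j.factorial : ℝ)) ^ 2 * (y / 2) ^ (2 * j)

open Finset in
theorem choose_mul_factorial_mul_factorial_eq_prod (n k : ℕ) :
    (n.choose k : ℝ) * (n + k).factorial * k.factorial =
      n.factorial * ∏ j ∈ range k, ((n : ℝ) ^ 2 + n - j * (j + 1)) := by
  induction k with
  | zero => simp
  | succ k ih =>
    have h : (n.choose (k + 1) : ℝ) * (k + 1) = n.choose k * (n - k) := by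
      rcases le_or_gt k n with hk | hk
      · have := Nat.choose_succ_right_eq n k
        rw [← Nat.cast_sub hk]
        exact_mod_cast this
      · simp [Nat.choose_eq_zero_of_lt hk, Nat.choose_eq_zero_of_lt (hk.trans k.lt_succ_self)]
    rw [prod_range_succ, ← mul_assoc, ← ih, ← add_assoc, Nat.factorial_succ, Nat.factorial_succ]
    push_cast
    linear_combination ((n : ℝ) + k + 1) * (n + k).factorial * k.factorial * h

open Finset in
theorem prod_range_eq_zero_of_lt {n k : ℕ} (h : n < k) :
    ∏ j ∈ range k, ((n : ℝ) ^ 2 + n - j * (j + 1)) = 0 :=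
  prod_eq_zero (mem_range.2 h) (by ring)

open Finset in
/-- The expansion of the Legendre polynomial at `x = 1`. -/
theorem legendre_eq_sum (n : ℕ) (x : ℝ) :
    legendre n x = ∑ k ∈ range (n + 1),
      (∏ j ∈ range k, ((n : ℝ) ^ 2 + n - j * (j + 1))) / (k.factorial : ℝ) ^ 2 *
        ((x - 1) / 2) ^ k := by
  have expand : (fun t : ℝ => (t ^ 2 - 1) ^ n) = fun t => ∑ k ∈ range (n + 1),
      ((n.choose k : ℝ) * 2 ^ (n - k)) * (t - 1) ^ (n + k) := by
    funext t
    rw [show t ^ 2 - 1 = (t - 1) * ((t - 1) + 2) by ring, mul_pow, add_pow, mul_sum]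
    refine sum_congr rfl fun k _ => ?_
    simp only [pow_add]
    ring
  rw [legendre, expand, iteratedDeriv_fun_sum (fun k _ => by fun_prop), mul_sum]
  refine sum_congr rfl fun k hk => ?_
  have hkn : k ≤ n := Nat.lt_succ_iff.1 (mem_range.1 hk)
  rw [iteratedDeriv_const_mul_field,
    congrFun (iteratedDeriv_comp_sub_const n (fun u : ℝ => u ^ (n + k)) 1) x, iteratedDeriv_pow,
    Nat.add_sub_cancel_left]
  have hd : (k.factorial : ℝ) * (n + k).descFactorial n = (n + k).factorial := by
    have := Nat.factorial_mul_descFactorial (Nat.le_add_right n k)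
    rw [Nat.add_sub_cancel_left] at this
    exact_mod_cast this
  have hc := choose_mul_factorial_mul_factorial_eq_prod n k
  have hn : (n.factorial : ℝ) ≠ 0 := by positivity
  have hk0 : (k.factorial : ℝ) ≠ 0 := by positivity
  have h2 : (2 : ℝ) ^ n = 2 ^ (n - k) * 2 ^ k := by rw [← pow_add, Nat.sub_add_cancel hkn]
  rw [← hd] at hc
  generalize ∏ j ∈ range k, ((n : ℝ) ^ 2 + n - j * (j + 1)) = Q at hc ⊢
  rw [div_pow, h2]
  field_simp
  linear_combination (x - 1) ^ k * hc

open Finset in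
theorem legendre_cos_eq_tsum (n : ℕ) (t : ℝ) :
    legendre n (cos (2 * t)) = ∑' k : ℕ, (-1) ^ k / (k.factorial : ℝ) ^ 2 *
      ∏ j ∈ range k, (((n : ℝ) ^ 2 + n - j * (j + 1)) * sin t ^ 2) := by
  rw [legendre_eq_sum, tsum_eq_sum (s := range (n + 1))]
  · refine sum_congr rfl fun k _ => ?_
    rw [prod_mul_distrib, prod_const, card_range, cos_two_mul, cos_sq',
      show (2 * (1 - sin t ^ 2) - 1 - 1) / 2 = -1 * sin t ^ 2 by ring, mul_pow]
    ring
  · intro k hk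
    have hk : n < k := by simpa [Nat.lt_succ_iff] using hk
    rw [prod_mul_distrib, prod_range_eq_zero_of_lt hk, zero_mul, mul_zero]

theorem sq_sub_sin_sq_le {t : ℝ} (ht : 0 ≤ t) : t ^ 2 - sin t ^ 2 ≤ t ^ 4 / 3 := by
  have h1 := sin_ge_sub_cube ht
  have h2 := sin_le ht
  have h3 : (t - sin t) * (t + sin t) ≤ t ^ 3 / 6 * (2 * t) :=
    mul_le_mul_of_nonneg (by linarith) (by linarith) (by linarith) (by positivity)
  linarith

theorem abs_factor_sub_le {c y : ℝ} (hy : y ∈ Set.Icc 0 c) {n : ℕ} (hn : 1 ≤ n) (j : ℕ) :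
    |((n : ℝ) ^ 2 + n - j * (j + 1)) * sin (y / (2 * n)) ^ 2 - (y / 2) ^ 2| ≤
      (c ^ 4 + c ^ 2) * (j + 1) ^ 2 / n := by
  have hn1 : (1 : ℝ) ≤ n := by exact_mod_cast hn
  have hn0 : (0 : ℝ) < n := by linarith
  obtain ⟨hy0, hyc⟩ := hy
  set t := y / (2 * n) with ht
  have ht0 : 0 ≤ t := by positivity
  have hyt : y = 2 * n * t := by rw [ht]; field_simp
  have hs : sin t ^ 2 ≤ t ^ 2 := sin_sq_le_sq
  have hs' := sq_sub_sin_sq_le ht0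
  have hj : (0 : ℝ) ≤ j := j.cast_nonneg
  have hc2 : (n * t) ^ 2 ≤ c ^ 2 := pow_le_pow_left₀ (by positivity) (by nlinarith) 2
  have hc4 : (n * t) ^ 4 ≤ c ^ 4 := pow_le_pow_left₀ (by positivity) (by nlinarith) 4
  have key : |((n : ℝ) ^ 2 + n - j * (j + 1)) * sin t ^ 2 - (y / 2) ^ 2| ≤
      n ^ 2 * (t ^ 4 / 3) + n * (j + 1) ^ 2 * t ^ 2 := by
    rw [show ((n : ℝ) ^ 2 + n - j * (j + 1)) * sin t ^ 2 - (y / 2) ^ 2 =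
      -(n ^ 2 * (t ^ 2 - sin t ^ 2)) + (n - j * (j + 1)) * sin t ^ 2 by rw [hyt]; ring]
    refine (abs_add_le _ _).trans (add_le_add ?_ ?_)
    · rw [abs_neg, abs_of_nonneg (mul_nonneg (by positivity) (by linarith))]
      gcongr
    · rw [abs_mul, abs_of_nonneg (sq_nonneg (sin t))]
      refine mul_le_mul ?_ hs (sq_nonneg _) (by positivity)
      rw [abs_le]
      constructor <;> nlinarith [mul_nonneg hj hj, mul_nonneg (mul_nonneg hj hj) (sub_nonneg.2 hn1),
        mul_nonneg hj (sub_nonneg.2 hn1)]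
  refine key.trans ?_
  rw [le_div_iff₀ hn0]
  have h1 : (n : ℝ) ^ 2 * (t ^ 4 / 3) * n ≤ c ^ 4 * 1 := by
    refine le_trans ?_ (by linarith : (n * t) ^ 4 ≤ c ^ 4 * 1)
    have : (n : ℝ) ^ 3 ≤ n ^ 4 := pow_le_pow_right₀ hn1 (by norm_num)
    have ht4 : 0 ≤ t ^ 4 := by positivity
    have hn3 : (0 : ℝ) ≤ n ^ 3 := by positivity
    nlinarith [mul_le_mul_of_nonneg_right this ht4, mul_nonneg hn3 ht4]
  have h2 : (n : ℝ) * (j + 1) ^ 2 * t ^ 2 * n ≤ c ^ 2 * (j + 1) ^ 2 := by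
    rw [show (n : ℝ) * (j + 1) ^ 2 * t ^ 2 * n = (n * t) ^ 2 * (j + 1) ^ 2 by ring]
    gcongr
  have h3 : c ^ 4 * 1 ≤ c ^ 4 * (j + 1) ^ 2 :=
    mul_le_mul_of_nonneg_left (one_le_pow₀ (by linarith)) (by positivity)
  linarith

open Finset in
theorem abs_prod_factor_le {c y : ℝ} (hy : y ∈ Set.Icc 0 c) {n : ℕ} (hn : 1 ≤ n) (k : ℕ) :
    |∏ j ∈ range k, (((n : ℝ) ^ 2 + n - j * (j + 1)) * sin (y / (2 * n)) ^ 2)| ≤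
      (1 + c ^ 2) ^ k := by
  have hn1 : (1 : ℝ) ≤ n := by exact_mod_cast hn
  rcases lt_or_ge n k with hk | hk
  · rw [prod_mul_distrib, prod_range_eq_zero_of_lt hk, zero_mul, abs_zero]
    positivity
  rw [abs_prod]
  refine (prod_le_prod (fun _ _ => abs_nonneg _) fun j hj => ?_).trans_eq
    ((prod_const _).trans (by rw [card_range]))
  have hjn : (j : ℝ) + 1 ≤ n := by exact_mod_cast (mem_range.1 hj).trans_le hk
  have hj0 : (0 : ℝ) ≤ j := j.cast_nonneg
  have hs : sin (y / (2 * n)) ^ 2 ≤ (y / (2 * n)) ^ 2 := sin_sq_le_sq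
  have hf : 0 ≤ (n : ℝ) ^ 2 + n - j * (j + 1) := by nlinarith
  rw [abs_of_nonneg (by positivity)]
  calc _ ≤ (2 * (n : ℝ) ^ 2) * (y / (2 * n)) ^ 2 :=
        mul_le_mul (by nlinarith) hs (sq_nonneg _) (by positivity)
    _ = y ^ 2 / 2 := by field_simp
    _ ≤ 1 + c ^ 2 := by nlinarith [hy.1, hy.2]

open Finset in
theorem abs_prod_factor_sub_pow_le {c y : ℝ} (hy : y ∈ Set.Icc 0 c) {n : ℕ} (hn : 1 ≤ n)
    (k : ℕ) :
    |∏ j ∈ range k, (((n : ℝ) ^ 2 + n - j * (j + 1)) * sin (y / (2 * n)) ^ 2) -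
      (y / 2) ^ (2 * k)| ≤ (c ^ 4 + c ^ 2) / n * (k ^ 3 * (1 + c ^ 2) ^ k) := by
  induction k with
  | zero => simp
  | succ k ih =>
    rw [prod_range_succ]
    have hP := abs_prod_factor_le hy hn k
    have hF := abs_factor_sub_le hy hn k
    set P := ∏ j ∈ range k, (((n : ℝ) ^ 2 + n - j * (j + 1)) * sin (y / (2 * n)) ^ 2)
    set F := ((n : ℝ) ^ 2 + n - k * (k + 1)) * sin (y / (2 * n)) ^ 2
    have hg : (y / 2) ^ 2 ≤ 1 + c ^ 2 := by nlinarith [hy.1, hy.2]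
    set M := 1 + c ^ 2
    have hM : 1 ≤ M := le_add_of_nonneg_right (sq_nonneg c)
    set K := (c ^ 4 + c ^ 2) / (n : ℝ) with hK
    have hK0 : 0 ≤ K := by positivity
    calc |P * F - (y / 2) ^ (2 * (k + 1))|
        = |P * (F - (y / 2) ^ 2) + (P - (y / 2) ^ (2 * k)) * (y / 2) ^ 2| := by congr 1; ring
      _ ≤ |P| * |F - (y / 2) ^ 2| + |P - (y / 2) ^ (2 * k)| * (y / 2) ^ 2 := by
          refine (abs_add_le _ _).trans_eq ?_
          rw [abs_mul, abs_mul, abs_of_nonneg (sq_nonneg (y / 2))]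
      _ ≤ M ^ k * (K * (k + 1) ^ 2) + K * (k ^ 3 * M ^ k) * M := by
          gcongr
          exact hF.trans_eq (by rw [hK]; ring)
      _ ≤ M ^ (k + 1) * (K * (k + 1) ^ 2) + K * (k ^ 3 * M ^ k) * M := by
          gcongr
          exact k.le_succ
      _ = K * (((k + 1) ^ 2 + k ^ 3) * M ^ (k + 1)) := by ring
      _ ≤ K * (((k + 1 : ℕ) : ℝ) ^ 3 * M ^ (k + 1)) := by
          gcongr
          push_cast
          have : (0 : ℝ) ≤ k := k.cast_nonneg
          nlinarith [sq_nonneg (k : ℝ)]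

theorem cast_pow_three_mul_pow_div_sq_factorial_le {M : ℝ} (hM : 0 ≤ M) (k : ℕ) :
    1 / (k.factorial : ℝ) ^ 2 * (k ^ 3 * M ^ k) ≤ (8 * M) ^ k / k.factorial := by
  have h1 : (1 : ℝ) ≤ k.factorial := by exact_mod_cast k.factorial_pos
  have h2 : (k : ℝ) ^ 3 ≤ 8 ^ k := by
    have : (k : ℝ) ≤ 2 ^ k := by exact_mod_cast k.lt_two_pow_self.le
    calc (k : ℝ) ^ 3 ≤ (2 ^ k) ^ 3 := by gcongr
      _ = 8 ^ k := by rw [← pow_mul, mul_comm, pow_mul]; norm_num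
  rw [mul_pow, one_div_mul_eq_div]
  gcongr
  exact le_self_pow₀ h1 two_ne_zero

theorem summable_of_abs_le_pow {a : ℕ → ℝ} {M : ℝ} (h : ∀ k, |a k| ≤ M ^ k) :
    Summable fun k : ℕ => (-1) ^ k / (k.factorial : ℝ) ^ 2 * a k := by
  refine Summable.of_norm_bounded (Real.summable_pow_div_factorial M) fun k => ?_
  have h1 : (1 : ℝ) ≤ k.factorial := by exact_mod_cast k.factorial_pos
  rw [norm_mul, norm_div, norm_pow, norm_neg, norm_one, one_pow, one_div_mul_eq_div,
    Real.norm_eq_abs, Real.norm_eq_abs,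
    abs_of_nonneg (by positivity : (0 : ℝ) ≤ (k.factorial : ℝ) ^ 2)]
  have := (abs_nonneg _).trans (h k)
  gcongr
  · exact h k
  · exact le_self_pow₀ h1 two_ne_zero

/-- For every `c > 0` there is `C` such that for all `n ≥ 1`,
`sup_{y ∈ [0,c]} |P_n(cos(y/n)) − J₀(y)| ≤ C/n`. -/
theorem legendre_rescaled_bessel_rate (c : ℝ) (hc : 0 < c) :
    ∃ C : ℝ, ∀ n : ℕ, 1 ≤ n → ∀ y ∈ Set.Icc (0 : ℝ) c,
      |legendre n (cos (y / n)) - besselJ0 y| ≤ C / n := by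
  set K := ∑' k : ℕ, (8 * (1 + c ^ 2)) ^ k / (k.factorial : ℝ)
  refine ⟨(c ^ 4 + c ^ 2) * K, fun n hn y hy => ?_⟩
  have hn0 : (n : ℝ) ≠ 0 := by positivity
  rw [show y / n = 2 * (y / (2 * n)) by field_simp, legendre_cos_eq_tsum, besselJ0,
    ← (summable_of_abs_le_pow (abs_prod_factor_le hy hn)).tsum_sub
      (summable_of_abs_le_pow (M := (y / 2) ^ 2) fun k => by
        rw [pow_mul, abs_of_nonneg (by positivity)]),
    mul_div_right_comm, ← Real.norm_eq_abs]
  refine tsum_of_norm_bounded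
    ((Real.summable_pow_div_factorial (8 * (1 + c ^ 2))).hasSum.mul_left _) fun k => ?_
  rw [← mul_sub, norm_mul, norm_div, norm_pow, norm_neg, norm_one, one_pow, Real.norm_eq_abs,
    Real.norm_eq_abs, abs_of_nonneg (by positivity : (0 : ℝ) ≤ (k.factorial : ℝ) ^ 2)]
  calc _ ≤ 1 / (k.factorial : ℝ) ^ 2 * ((c ^ 4 + c ^ 2) / n * (k ^ 3 * (1 + c ^ 2) ^ k)) :=
        mul_le_mul_of_nonneg_left (abs_prod_factor_sub_pow_le hy hn k) (by positivity)
    _ = (c ^ 4 + c ^ 2) / n * (1 / (k.factorial : ℝ) ^ 2 * (k ^ 3 * (1 + c ^ 2) ^ k)) := by ring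
    _ ≤ _ := mul_le_mul_of_nonneg_left
        (cast_pow_three_mul_pow_div_sq_factorial_le (by positivity) k) (by positivity)
end

section
/- For each d ≥ 2 and every c > 0, sup_{y ∈ [0, c]} | P_{n,d}(cos(y/n)) − J_∞^d(y) | → 0 as n → ∞. -/
open Real

/-- The Gegenbauer (ultraspherical) polynomial `C_n^λ`, via its explicit sum. -/
noncomputable def gegenbauerC (lam : ℝ) (n : ℕ) (x : ℝ) : ℝ :=
  ∑ k ∈ Finset.range (n / 2 + 1),
    (-1) ^ k * Real.Gamma ((n - k : ℕ) + lam) /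
        (Real.Gamma lam * (k.factorial : ℝ) * ((n - 2 * k).factorial : ℝ)) *
      (2 * x) ^ (n - 2 * k)

/-- The Legendre polynomial of degree `n` in dimension `d+1`: the Gegenbauer polynomial
`C_n^{((d−1)/2)}` normalized so that its value at `1` is `1`. -/
noncomputable def legendreDim (d n : ℕ) (x : ℝ) : ℝ :=
  gegenbauerC (((d : ℝ) - 1) / 2) n x / gegenbauerC (((d : ℝ) - 1) / 2) n 1

/-- The normalized Bessel function
`J_∞^d(y) = Σ_{j≥0} (−1)^j Γ(d/2)/(j! Γ(j+d/2)) (y/2)^{2j}`. -/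
noncomputable def besselJdim (d : ℕ) (y : ℝ) : ℝ :=
  ∑' j : ℕ, (-1) ^ j * Real.Gamma ((d : ℝ) / 2) /
      ((j.factorial : ℝ) * Real.Gamma ((j : ℝ) + (d : ℝ) / 2)) * (y / 2) ^ (2 * j)


open Polynomial in
/-- `gegenbauerC` as a polynomial. -/
noncomputable def gegenbauerPoly (lam : ℝ) (n : ℕ) : ℝ[X] :=
  ∑ k ∈ Finset.range (n / 2 + 1),
    C ((-1) ^ k * Real.Gamma ((n - k : ℕ) + lam) /
        (Real.Gamma lam * (k.factorial : ℝ) * ((n - 2 * k).factorial : ℝ)) *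
      2 ^ (n - 2 * k)) * X ^ (n - 2 * k)

lemma eval_gegenbauerPoly (lam : ℝ) (n : ℕ) (x : ℝ) :
    (gegenbauerPoly lam n).eval x = gegenbauerC lam n x := by
  simp only [gegenbauerPoly, gegenbauerC, Polynomial.eval_finsetSum, Polynomial.eval_mul,
    Polynomial.eval_C, Polynomial.eval_pow, Polynomial.eval_X, mul_pow, mul_assoc]

lemma gegenbauerPoly_ne_zero {lam : ℝ} (hlam : 0 < lam) (n : ℕ) : gegenbauerPoly lam n ≠ 0 := by
  intro h
  have h0 : (gegenbauerPoly lam n).coeff n = 0 := by simp [h]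
  rw [gegenbauerPoly, Polynomial.finsetSum_coeff, Finset.sum_eq_single_of_mem 0 (by simp)] at h0
  · have h1 := (Real.Gamma_pos_of_pos hlam).ne'
    have h2 : Real.Gamma ((n : ℝ) + lam) ≠ 0 := (Real.Gamma_pos_of_pos (by positivity)).ne'
    have h3 : (n.factorial : ℝ) ≠ 0 := by positivity
    rw [Polynomial.coeff_C_mul_X_pow] at h0
    simp [h1, h2, h3] at h0
  · intro k hk hk0
    rw [Finset.mem_range] at hk
    rw [Polynomial.coeff_C_mul_X_pow, if_neg (by omega)]

open Polynomial in
/-- The Gegenbauer differential equation. -/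
lemma gegenbauerPoly_ode {lam : ℝ} (hlam : 0 < lam) (n : ℕ) :
    (1 - X ^ 2) * derivative (derivative (gegenbauerPoly lam n))
      - C (2 * lam + 1) * X * derivative (gegenbauerPoly lam n)
      + C (n * (n + 2 * lam)) * gegenbauerPoly lam n = 0 := by
  set t : ℕ → ℝ := fun k => (-1) ^ k * Real.Gamma ((n - k : ℕ) + lam) /
        (Real.Gamma lam * (k.factorial : ℝ) * ((n - 2 * k).factorial : ℝ)) *
      2 ^ (n - 2 * k) with ht
  set s : ℕ → ℝ[X] := fun k => C (t k * (4 * k * (n - k + lam))) * X ^ (n - 2 * k) with hs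
  have hrec : ∀ m k : ℕ, n = m + 2 * k + 2 →
      t (k + 1) * (4 * (k + 1) * (n - (k + 1) + lam)) = - (t k * ((m + 2) * (m + 1))) := by
    intro m k hn
    have e1 : n - k = m + k + 1 + 1 := by omega
    have e2 : n - (k + 1) = m + k + 1 := by omega
    have e3 : n - 2 * k = m + 1 + 1 := by omega
    have e4 : n - 2 * (k + 1) = m := by omega
    have hG : Real.Gamma (((m + k + 1 + 1 : ℕ) : ℝ) + lam)
        = ((m + k + 1 : ℕ) + lam) * Real.Gamma ((m + k + 1 : ℕ) + lam) := by
      rw [← Real.Gamma_add_one (by positivity)]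
      push_cast; ring_nf
    have h1 := (Real.Gamma_pos_of_pos hlam).ne'
    have h2 : (k.factorial : ℝ) ≠ 0 := by positivity
    have h3 : (m.factorial : ℝ) ≠ 0 := by positivity
    simp only [ht, e1, e2, e3, e4, hG, Nat.factorial_succ]
    rw [hn]
    push_cast
    field_simp
    ring
  have hmono : ∀ (a : ℝ) (m : ℕ),
      (1 - X ^ 2) * derivative (derivative (C a * X ^ m))
        - C (2 * lam + 1) * X * derivative (C a * X ^ m)
        + C (n * (n + 2 * lam)) * (C a * X ^ m)
      = C (a * (m * (m - 1))) * X ^ (m - 2)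
        + C (a * (n * (n + 2 * lam) - m * (m + 2 * lam))) * X ^ m := by
    intro a m
    rcases m with _ | _ | m
    · simp; ring
    · simp; ring
    · simp [derivative_mul]
      ring
  have hstep : ∀ k ∈ Finset.range (n / 2),
      (1 - X ^ 2) * derivative (derivative (C (t k) * X ^ (n - 2 * k)))
        - C (2 * lam + 1) * X * derivative (C (t k) * X ^ (n - 2 * k))
        + C (n * (n + 2 * lam)) * (C (t k) * X ^ (n - 2 * k)) = s k - s (k + 1) := by
    intro k hk
    rw [Finset.mem_range] at hk
    obtain ⟨m, hm⟩ : ∃ m, n = m + 2 * k + 2 := ⟨n - 2 * k - 2, by omega⟩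
    have e3 : n - 2 * k = m + 2 := by omega
    have e4 : n - 2 * (k + 1) = m := by omega
    have hr := hrec m k hm
    have ha : t k * (((m + 2 : ℕ) : ℝ) * ((m + 2 : ℕ) - 1)) = t k * ((m + 2) * (m + 1)) := by
      push_cast; ring
    have hb : t k * (n * (n + 2 * lam) - ((m + 2 : ℕ) : ℝ) * ((m + 2 : ℕ) + 2 * lam))
        = t k * (4 * k * (n - k + lam)) := by
      rw [hm]; push_cast; ring
    simp only [hmono, hs, e3, e4, Nat.add_sub_cancel, ha, hb]
    rw [Nat.cast_add_one, hr, C_neg]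
    ring
  have hlast : (1 - X ^ 2) * derivative (derivative (C (t (n / 2)) * X ^ (n - 2 * (n / 2))))
        - C (2 * lam + 1) * X * derivative (C (t (n / 2)) * X ^ (n - 2 * (n / 2)))
        + C (n * (n + 2 * lam)) * (C (t (n / 2)) * X ^ (n - 2 * (n / 2))) = s (n / 2) := by
    generalize hk : n / 2 = k
    obtain h | h : n = 2 * k ∨ n = 2 * k + 1 := by omega
    · have e : n - 2 * k = 0 := by omega
      have hb : t k * (n * (n + 2 * lam) - ((0 : ℕ) : ℝ) * ((0 : ℕ) + 2 * lam))
          = t k * (4 * k * (n - k + lam)) := by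
        rw [h]; push_cast; ring
      simp only [hmono, hs, e, hb]
      simp
    · have e : n - 2 * k = 1 := by omega
      have hb : t k * (n * (n + 2 * lam) - ((1 : ℕ) : ℝ) * ((1 : ℕ) + 2 * lam))
          = t k * (4 * k * (n - k + lam)) := by
        rw [h]; push_cast; ring
      simp only [hmono, hs, e, hb]
      simp
  have hG : gegenbauerPoly lam n
      = ∑ k ∈ Finset.range (n / 2 + 1), C (t k) * X ^ (n - 2 * k) := rfl
  rw [hG]
  simp only [derivative_sum, Finset.mul_sum]
  rw [← Finset.sum_sub_distrib, ← Finset.sum_add_distrib, Finset.sum_range_succ,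
    Finset.sum_congr rfl hstep, hlast, Finset.sum_range_sub']
  simp [hs]

open Polynomial in
lemma gegenbauerPoly_comp_ode {lam : ℝ} (hlam : 0 < lam) (n : ℕ) (H : ℝ[X])
    (hH : H = (gegenbauerPoly lam n).comp (1 - C 2 * X)) :
    X * derivative (derivative H) - X * (X * derivative (derivative H))
      + C (lam + 1 / 2) * derivative H - C (2 * lam + 1) * (X * derivative H)
      + C (n * (n + 2 * lam)) * H = 0 := by
  have h := congrArg (fun p => p.comp (1 - C 2 * X)) (gegenbauerPoly_ode hlam n)
  have h1 : derivative H = - C 2 * (derivative (gegenbauerPoly lam n)).comp (1 - C 2 * X) := by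
    rw [hH, derivative_comp]; simp
  have h2 : derivative (derivative H)
      = C 4 * (derivative (derivative (gegenbauerPoly lam n))).comp (1 - C 2 * X) := by
    rw [h1, derivative_mul, derivative_comp]
    simp only [derivative_neg, derivative_C, derivative_sub, derivative_one, derivative_mul,
      derivative_X]
    rw [show (4 : ℝ) = 2 * 2 by norm_num, C_mul]
    ring
  rw [h2, h1, hH]
  simp only [add_comp, sub_comp, mul_comp, C_comp, X_comp, one_comp, pow_comp, zero_comp] at h
  rw [← h]
  have e : C (lam + 1 / 2) * C 2 = C (2 * lam + 1) := by rw [← C_mul]; congr 1; ring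
  rw [← e, show (4 : ℝ) = 2 * 2 by norm_num, C_mul]
  have e2 : (C 2 : ℝ[X]) = 2 := rfl
  rw [e2]
  ring

lemma coeff_gegenbauerPoly_comp {lam : ℝ} (hlam : 0 < lam) (n j : ℕ) :
    ((gegenbauerPoly lam n).comp (1 - Polynomial.C 2 * Polynomial.X)).coeff j
      = gegenbauerC lam n 1 * ∏ i ∈ Finset.range j,
        (((i : ℝ) - n) * (i + n + 2 * lam) / ((i + 1) * (i + (lam + 1 / 2)))) := by
  set H := (gegenbauerPoly lam n).comp (1 - Polynomial.C 2 * Polynomial.X) with hH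
  have hode := gegenbauerPoly_comp_ode hlam n H hH
  induction j with
  | zero =>
    rw [Polynomial.coeff_zero_eq_eval_zero, hH, Polynomial.eval_comp,
      ← eval_gegenbauerPoly lam n 1]
    simp
  | succ j ih =>
    have h := congrArg (fun p => p.coeff j) hode
    rw [Finset.prod_range_succ, ← mul_assoc, ← ih]
    have key : ((j : ℝ) + 1) * (j + (lam + 1 / 2)) * H.coeff (j + 1)
        = (j - n) * (j + n + 2 * lam) * H.coeff j := by
      rcases j with _ | _ | j <;>
      · simp only [Polynomial.coeff_add, Polynomial.coeff_sub, Polynomial.coeff_C_mul,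
          Polynomial.coeff_X_mul, Polynomial.coeff_X_mul_zero, Polynomial.coeff_derivative,
          Polynomial.coeff_zero] at h
        push_cast at h ⊢
        linear_combination h
    have hp : ((j : ℝ) + 1) * (j + (lam + 1 / 2)) ≠ 0 := by positivity
    rw [← mul_div_assoc, eq_div_iff hp]
    linarith

/-- The hypergeometric expansion of the Gegenbauer polynomials around `1`. -/
lemma gegenbauerC_eq_tsum {lam : ℝ} (hlam : 0 < lam) (n : ℕ) (x : ℝ) :
    gegenbauerC lam n x = gegenbauerC lam n 1 * ∑' j : ℕ, ∏ i ∈ Finset.range j,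
      (((i : ℝ) - n) * (i + n + 2 * lam) / ((i + 1) * (i + (lam + 1 / 2))) * ((1 - x) / 2)) := by
  have h : gegenbauerC lam n x = ((gegenbauerPoly lam n).comp
      (1 - Polynomial.C 2 * Polynomial.X)).eval ((1 - x) / 2) := by
    rw [Polynomial.eval_comp, ← eval_gegenbauerPoly lam n x]
    congr 1
    simp
    ring
  rw [h, Polynomial.eval_eq_sum_range, ← tsum_mul_left,
    tsum_eq_sum (s := Finset.range (((gegenbauerPoly lam n).comp
      (1 - Polynomial.C 2 * Polynomial.X)).natDegree + 1))]
  · refine Finset.sum_congr rfl fun j _ => ?_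
    rw [coeff_gegenbauerPoly_comp hlam, Finset.prod_mul_distrib, Finset.prod_const,
      Finset.card_range, mul_assoc]
  · intro j hj
    rw [Finset.mem_range, not_lt] at hj
    rw [Finset.prod_mul_distrib, ← mul_assoc, ← coeff_gegenbauerPoly_comp hlam,
      Polynomial.coeff_eq_zero_of_natDegree_lt (by omega), zero_mul]

lemma gegenbauerC_one_ne_zero {lam : ℝ} (hlam : 0 < lam) (n : ℕ) : gegenbauerC lam n 1 ≠ 0 := by
  intro h
  refine gegenbauerPoly_ne_zero hlam n (Polynomial.funext fun x => ?_)
  rw [eval_gegenbauerPoly, gegenbauerC_eq_tsum hlam, h, zero_mul, Polynomial.eval_zero]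

lemma legendreDim_eq_tsum {d : ℕ} (hd : 2 ≤ d) (n : ℕ) (x : ℝ) :
    legendreDim d n x = ∑' j : ℕ, ∏ i ∈ Finset.range j,
      (((i : ℝ) - n) * (i + n + (d - 1)) / ((i + 1) * (i + d / 2)) * ((1 - x) / 2)) := by
  have hd' : (2 : ℝ) ≤ d := by exact_mod_cast hd
  have hlam : 0 < ((d : ℝ) - 1) / 2 := by linarith
  rw [legendreDim, gegenbauerC_eq_tsum hlam,
    mul_div_cancel_left₀ _ (gegenbauerC_one_ne_zero hlam n)]
  refine tsum_congr fun j => Finset.prod_congr rfl fun i _ => ?_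
  congr 4 <;> ring

lemma besselJdim_eq_tsum {d : ℕ} (hd : 2 ≤ d) (y : ℝ) :
    besselJdim d y = ∑' j : ℕ, ∏ i ∈ Finset.range j,
      (-(y / 2) ^ 2 / (((i : ℝ) + 1) * (i + d / 2))) := by
  have hd' : (0 : ℝ) < d := by exact_mod_cast (by omega : 0 < d)
  refine tsum_congr fun j => ?_
  have hG : Real.Gamma ((d : ℝ) / 2) ≠ 0 := (Real.Gamma_pos_of_pos (by positivity)).ne'
  induction j with
  | zero => simp [hG]
  | succ j ih =>
    have h1 : Real.Gamma (((j + 1 : ℕ) : ℝ) + (d : ℝ) / 2)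
        = (j + d / 2) * Real.Gamma (j + d / 2) := by
      rw [← Real.Gamma_add_one (by positivity)]
      push_cast; ring_nf
    have h2 : Real.Gamma ((j : ℝ) + d / 2) ≠ 0 := (Real.Gamma_pos_of_pos (by positivity)).ne'
    have h3 : (j.factorial : ℝ) ≠ 0 := by positivity
    have h4 : (j : ℝ) + d / 2 ≠ 0 := by positivity
    rw [Finset.prod_range_succ, ← ih, h1, Nat.factorial_succ]
    push_cast
    field_simp
    ring

lemma one_sub_cos_div_eq_sinc {n : ℕ} (hn : 0 < n) (y : ℝ) :
    (1 - cos (y / n)) / 2 = (y / 2 * sinc (y / 2 / n)) ^ 2 / n ^ 2 := by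
  have hn' : (n : ℝ) ≠ 0 := by positivity
  rcases eq_or_ne y 0 with rfl | hy
  · simp
  · rw [Real.sinc_of_ne_zero (by positivity), show y / n = 2 * (y / 2 / n) by ring,
      Real.cos_two_mul, Real.cos_sq']
    field_simp
    ring

lemma abs_legendre_factor_le {d n i : ℕ} (hd : 2 ≤ d) (hi : i < n) {c y : ℝ} (hy : |y| ≤ c) :
    |((i : ℝ) - n) * (i + n + (d - 1)) / ((i + 1) * (i + d / 2)) * ((1 - cos (y / n)) / 2)|
      ≤ (d + 1) * c ^ 2 / (i + 1) := by
  have hd' : (2 : ℝ) ≤ d := by exact_mod_cast hd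
  have hi' : (i : ℝ) + 1 ≤ n := by exact_mod_cast hi
  have hi0 : (0 : ℝ) ≤ i := i.cast_nonneg
  have hn : (0 : ℝ) < n := by linarith
  have hz : |(1 - cos (y / n)) / 2| ≤ c ^ 2 / n ^ 2 := by
    rw [one_sub_cos_div_eq_sinc (by omega), abs_div, abs_pow, abs_mul, abs_pow, Nat.abs_cast,
      abs_div, abs_two]
    have h1 : |y| / 2 * |sinc (y / 2 / n)| ≤ c := by
      have := Real.abs_sinc_le_one (y / 2 / n)
      nlinarith [abs_nonneg y]
    gcongr
  have h1 : |(i : ℝ) - n| ≤ n := by rw [abs_le]; constructor <;> linarith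
  have h2 : |(i : ℝ) + n + (d - 1)| ≤ (d + 1) * n := by
    rw [abs_of_nonneg (by linarith)]
    nlinarith
  have h3 : (i : ℝ) + 1 ≤ |((i : ℝ) + 1) * (i + d / 2)| := by
    rw [abs_of_nonneg (by positivity)]
    nlinarith
  rw [abs_mul, abs_div, abs_mul]
  calc |(i : ℝ) - n| * |(i : ℝ) + n + (d - 1)| / |((i : ℝ) + 1) * (i + d / 2)|
        * |(1 - cos (y / n)) / 2|
      ≤ n * ((d + 1) * n) / (i + 1) * (c ^ 2 / n ^ 2) := by gcongr
    _ = (d + 1) * c ^ 2 / (i + 1) := by field_simp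

lemma abs_legendre_prod_le {d n : ℕ} (hd : 2 ≤ d) (j : ℕ) {c y : ℝ} (hy : |y| ≤ c) :
    |∏ i ∈ Finset.range j,
      (((i : ℝ) - n) * (i + n + (d - 1)) / ((i + 1) * (i + d / 2)) * ((1 - cos (y / n)) / 2))|
      ≤ ((d + 1) * c ^ 2) ^ j / j.factorial := by
  rcases le_or_gt j n with hj | hj
  · have h : ((d + 1) * c ^ 2) ^ j / j.factorial
        = ∏ i ∈ Finset.range j, (((d : ℝ) + 1) * c ^ 2 / (i + 1)) := by
      rw [Finset.prod_div_distrib, Finset.prod_const, Finset.card_range,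
        ← Finset.prod_range_add_one_eq_factorial]
      push_cast
      rfl
    rw [h, Finset.abs_prod]
    exact Finset.prod_le_prod (fun i _ => abs_nonneg _) fun i hi =>
      abs_legendre_factor_le hd (by rw [Finset.mem_range] at hi; omega) hy
  · rw [Finset.prod_eq_zero (Finset.mem_range.2 hj) (by simp), abs_zero]
    positivity

lemma tendsto_legendre_factor (d i : ℕ) (x : ℝ) :
    Filter.Tendsto (fun q : ℕ × ℝ =>
      ((i : ℝ) - q.1) * (i + q.1 + (d - 1)) / ((i + 1) * (i + d / 2))
        * ((1 - cos (q.2 / q.1)) / 2))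
      (Filter.atTop ×ˢ nhds x) (nhds (-(x / 2) ^ 2 / (((i : ℝ) + 1) * (i + d / 2)))) := by
  have hn : Filter.Tendsto (fun q : ℕ × ℝ => (q.1 : ℝ)⁻¹) (Filter.atTop ×ˢ nhds x) (nhds 0) :=
    tendsto_inv_atTop_nhds_zero_nat.comp Filter.tendsto_fst
  have hy : Filter.Tendsto (fun q : ℕ × ℝ => q.2 / 2) (Filter.atTop ×ˢ nhds x) (nhds (x / 2)) :=
    Filter.tendsto_snd.div_const 2
  have hs : Filter.Tendsto (fun q : ℕ × ℝ => sinc (q.2 / 2 * (q.1 : ℝ)⁻¹))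
      (Filter.atTop ×ˢ nhds x) (nhds 1) := by
    have := (Real.continuous_sinc.tendsto (x / 2 * 0)).comp (hy.mul hn)
    simpa [Function.comp_def] using this
  have h := (((hn.const_mul (i : ℝ)).sub_const 1).mul
    ((hn.const_mul ((i : ℝ) + (d - 1))).add_const 1)).mul ((hy.mul hs).pow 2)
  have h' := h.div_const (((i : ℝ) + 1) * (i + d / 2))
  have e : ((i : ℝ) * 0 - 1) * (((i : ℝ) + (d - 1)) * 0 + 1) * (x / 2 * 1) ^ 2
      = -(x / 2) ^ 2 := by ring
  rw [e] at h'
  refine h'.congr' ?_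
  filter_upwards [(Filter.eventually_gt_atTop 0).prod_inl (nhds x)] with q hq
  have hq' : (q.1 : ℝ) ≠ 0 := by positivity
  rw [one_sub_cos_div_eq_sinc hq, ← div_eq_mul_inv (q.2 / 2)]
  field_simp
  ring

lemma tendsto_legendreDim_cos {d : ℕ} (hd : 2 ≤ d) (x : ℝ) :
    Filter.Tendsto (fun q : ℕ × ℝ => legendreDim d q.1 (cos (q.2 / q.1)))
      (Filter.atTop ×ˢ nhds x) (nhds (besselJdim d x)) := by
  simp only [legendreDim_eq_tsum hd, besselJdim_eq_tsum hd]
  refine tendsto_tsum_of_dominated_convergence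
    (Real.summable_pow_div_factorial ((d + 1) * (|x| + 1) ^ 2))
    (fun j => tendsto_finsetProd _ fun i _ => tendsto_legendre_factor d i x) ?_
  have hx : ∀ᶠ y in nhds x, |y| ≤ |x| + 1 :=
    (continuous_abs.tendsto x).eventually (eventually_le_nhds (by linarith))
  filter_upwards [hx.prod_inr Filter.atTop] with q hq j
  exact abs_legendre_prod_le hd j hq

lemma abs_bessel_prod_le {d : ℕ} (hd : 2 ≤ d) (j : ℕ) {c y : ℝ} (hy : |y| ≤ c) :
    |∏ i ∈ Finset.range j, (-(y / 2) ^ 2 / (((i : ℝ) + 1) * (i + d / 2)))|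
      ≤ (c ^ 2) ^ j / j.factorial := by
  have hd' : (2 : ℝ) ≤ d := by exact_mod_cast hd
  have h : (c ^ 2) ^ j / j.factorial = ∏ i ∈ Finset.range j, (c ^ 2 / ((i : ℝ) + 1)) := by
    rw [Finset.prod_div_distrib, Finset.prod_const, Finset.card_range,
      ← Finset.prod_range_add_one_eq_factorial]
    push_cast
    rfl
  rw [h, Finset.abs_prod]
  refine Finset.prod_le_prod (fun i _ => abs_nonneg _) fun i _ => ?_
  have hi0 : (0 : ℝ) ≤ i := i.cast_nonneg
  have h1 : |y| / 2 ≤ c := by linarith [abs_nonneg y]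
  have h2 : (i : ℝ) + 1 ≤ |((i : ℝ) + 1) * (i + d / 2)| := by
    rw [abs_of_nonneg (by positivity)]
    nlinarith
  rw [abs_div, abs_neg, abs_pow, abs_div, abs_two]
  gcongr

lemma continuous_besselJdim {d : ℕ} (hd : 2 ≤ d) : Continuous (besselJdim d) := by
  rw [funext (besselJdim_eq_tsum hd)]
  refine continuous_iff_continuousAt.2 fun x => ?_
  refine tendsto_tsum_of_dominated_convergence
    (Real.summable_pow_div_factorial ((|x| + 1) ^ 2))
    (fun j => Continuous.tendsto (by fun_prop) x) ?_
  have hx : ∀ᶠ y in nhds x, |y| ≤ |x| + 1 :=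
    (continuous_abs.tendsto x).eventually (eventually_le_nhds (by linarith))
  filter_upwards [hx] with y hy j
  exact abs_bessel_prod_le hd j hy

/-- For each `d ≥ 2` and `c > 0`, `sup_{y ∈ [0,c]} |P_{n,d}(cos(y/n)) − J_∞^d(y)| → 0`
as `n → ∞`. -/
theorem legendreDim_rescaled_bessel (d : ℕ) (hd : 2 ≤ d) (c : ℝ) (hc : 0 < c) :
    ∀ ε : ℝ, 0 < ε → ∃ N : ℕ, ∀ n : ℕ, N ≤ n → ∀ y ∈ Set.Icc (0 : ℝ) c,
      |legendreDim d n (cos (y / n)) - besselJdim d y| < ε := by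
  have h : TendstoUniformlyOn (fun (n : ℕ) y => legendreDim d n (cos (y / n))) (besselJdim d)
      Filter.atTop (Set.Icc 0 c) := by
    rw [← tendstoLocallyUniformlyOn_iff_tendstoUniformlyOn_of_compact isCompact_Icc,
      tendstoLocallyUniformlyOn_iff_forall_tendsto]
    intro x _
    have hmono : (Filter.atTop : Filter ℕ) ×ˢ nhdsWithin x (Set.Icc 0 c)
        ≤ Filter.atTop ×ˢ nhds x := Filter.prod_mono le_rfl nhdsWithin_le_nhds
    have hJ := ((continuous_besselJdim hd).tendsto x).comp
      (Filter.tendsto_snd (f := (Filter.atTop : Filter ℕ)))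
    exact ((hJ.prodMk_nhds (tendsto_legendreDim_cos hd x)).mono_left hmono).mono_right
      (nhds_le_uniformity _)
  intro ε hε
  obtain ⟨N, hN⟩ := Filter.eventually_atTop.1 (Metric.tendstoUniformlyOn_iff.1 h ε hε)
  refine ⟨N, fun n hn y hy => ?_⟩
  rw [← Real.dist_eq, dist_comm]
  exact hN n hn y hy
end
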